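/- arXiv:1203.5808 — 2 statements merged into one kernel-verified Lean document; each statement's English description precedes it below -/
import Mathlib

section
/- For d ∈ {2, 3, 4}, the per-site trace of the squared inverse Dirichlet Laplacian on the box Λ_N = {0, …, N−1}^d diverges: N^{-d} Σ_{x∈Λ_N} ((−Δ_{Λ_N})^{-2})(x,x) → ∞ as N → ∞. (This expresses that the disorder contribution ε² Δ_Λ^{-2}(x,y) to the averaged two-point function of the random field Gaussian model grows with the volume in dimensions d ≤ 4.) -/
open scoped Classical BigOperators
open MeasureTheory Filter

noncomputable section

/-- A site of the lattice `ℤ^d`. -/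
abbrev Site (d : ℕ) := Fin d → ℤ

/-- The ℓ¹ distance on `ℤ^d`; nearest neighbors are at ℓ¹ distance 1. -/
def l1dist {d : ℕ} (x y : Site d) : ℤ := ∑ i, |x i - y i|

/-- The box `{a,…,b}^d` as a Finset of `ℤ^d`. -/
def latBox (d : ℕ) (a b : ℤ) : Finset (Site d) := Fintype.piFinset fun _ => Finset.Icc a b

/-- The Dirichlet Laplacian `−Δ_Λ` of a finite region `Λ ⊂ ℤ^d`, as a matrix:
`(−Δ_Λ f)(x) = 2d·f(x) − Σ_{y∈Λ, ‖y−x‖₁=1} f(y)`. -/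
def dirLap (d : ℕ) (Λ : Finset (Site d)) : Matrix Λ Λ ℝ := fun x y =>
  if (x : Site d) = (y : Site d) then (2 * d : ℝ)
  else if l1dist (x : Site d) (y : Site d) = 1 then -1 else 0

/-- If the columns of an invertible `S` are eigenvectors of `A` with nonzero eigenvalues `μ`,
the trace of `A⁻²` is the sum of the `μ i ^ (-2)`. -/
lemma trace_inv_mul_inv_of_mul_eq_mul_diagonal {n : Type*} [Fintype n] [DecidableEq n]
    {A S : Matrix n n ℝ} {μ : n → ℝ} (hS : IsUnit S.det)
    (h : A * S = S * Matrix.diagonal μ) (hμ : ∀ i, μ i ≠ 0) :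
    (A⁻¹ * A⁻¹).trace = ∑ i, ((μ i) ^ 2)⁻¹ := by
  have hinv : A⁻¹ = S * Matrix.diagonal (fun i => (μ i)⁻¹) * S⁻¹ := by
    apply Matrix.inv_eq_right_inv
    have hD : Matrix.diagonal μ * Matrix.diagonal (fun i => (μ i)⁻¹) = 1 := by
      rw [Matrix.diagonal_mul_diagonal, ← Matrix.diagonal_one]
      congr 1
      funext i
      exact mul_inv_cancel₀ (hμ i)
    rw [← mul_assoc, ← mul_assoc, h, mul_assoc S, hD, mul_one, Matrix.mul_nonsing_inv S hS]
  have hsq : A⁻¹ * A⁻¹ = S * (Matrix.diagonal (fun i => ((μ i) ^ 2)⁻¹) * S⁻¹) := by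
    rw [hinv]
    calc _ = S * Matrix.diagonal (fun i => (μ i)⁻¹) * (S⁻¹ * S)
          * Matrix.diagonal (fun i => (μ i)⁻¹) * S⁻¹ := by simp only [mul_assoc]
      _ = S * (Matrix.diagonal (fun i => (μ i)⁻¹) * Matrix.diagonal (fun i => (μ i)⁻¹)) * S⁻¹ := by
          rw [Matrix.nonsing_inv_mul S hS, mul_one, mul_assoc S]
      _ = _ := by
          rw [Matrix.diagonal_mul_diagonal, mul_assoc]
          congr 4
          funext i
          rw [sq, mul_inv]
  rw [hsq, Matrix.trace_mul_comm, mul_assoc, Matrix.nonsing_inv_mul S hS, mul_one,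
    Matrix.trace_diagonal]

/-- Entries of the one-dimensional lattice Laplacian `−Δ`. -/
def lapKernel (a b : ℤ) : ℝ :=
  (if b = a then 2 else 0) - (if b = a - 1 then 1 else 0) - (if b = a + 1 then 1 else 0)

/-- The frequency of the `k`-th Dirichlet mode on `{0,…,N−1}`. -/
def modeFreq (N : ℕ) (k : ℤ) : ℝ := Real.pi * ((k : ℝ) + 1) / ((N : ℝ) + 1)

/-- The `k`-th Dirichlet mode on `{0,…,N−1}`. -/
def sineMode (N : ℕ) (a k : ℤ) : ℝ := Real.sin (((a : ℝ) + 1) * modeFreq N k)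

/-- The eigenvalue of the `k`-th Dirichlet mode. -/
def modeEigenvalue (N : ℕ) (k : ℤ) : ℝ := 2 - 2 * Real.cos (modeFreq N k)

lemma lapKernel_comm (a b : ℤ) : lapKernel a b = lapKernel b a := by
  have h1 : (b = a) = (a = b) := by grind
  have h2 : (b = a - 1) = (a = b + 1) := by grind
  have h3 : (b = a + 1) = (a = b - 1) := by grind
  simp only [lapKernel, h1, h2, h3]
  ring

lemma lapKernel_self (a : ℤ) : lapKernel a a = 2 := by
  have h : a ≠ a - 1 := by omega
  simp [lapKernel, h]

lemma lapKernel_of_ne {a b : ℤ} (h : a ≠ b) :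
    lapKernel a b = if |a - b| = 1 then -1 else 0 := by
  unfold lapKernel
  have : (|a - b| = 1) ↔ (b = a - 1 ∨ b = a + 1) := by
    rw [abs_eq (by norm_num)]; omega
  simp only [this]
  split_ifs <;> first | omega | norm_num

lemma modeFreq_mem_Ioo {N : ℕ} {k : ℤ} (hk : k ∈ Finset.Icc (0 : ℤ) (N - 1)) :
    modeFreq N k ∈ Set.Ioo 0 Real.pi := by
  obtain ⟨h0, h1⟩ := Finset.mem_Icc.mp hk
  have h0' : (0 : ℝ) ≤ k := by exact_mod_cast h0
  have h1' : (k : ℝ) ≤ N - 1 := by exact_mod_cast h1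
  have hpi := Real.pi_pos
  refine ⟨by unfold modeFreq; positivity, ?_⟩
  unfold modeFreq
  rw [div_lt_iff₀ (by positivity)]
  nlinarith

lemma sum_lapKernel_mul_sineMode {N : ℕ} {a : ℤ} (k : ℤ)
    (ha : a ∈ Finset.Icc (0 : ℤ) (N - 1)) :
    ∑ b ∈ Finset.Icc (0 : ℤ) (N - 1), lapKernel a b * sineMode N b k
      = modeEigenvalue N k * sineMode N a k := by
  have hleft : sineMode N (-1) k = 0 := by simp [sineMode]
  have hright : sineMode N N k = 0 := by
    have : ((((N : ℤ) : ℝ)) + 1) * modeFreq N k = ((k + 1 : ℤ) : ℝ) * Real.pi := by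
      unfold modeFreq
      push_cast
      field_simp
    rw [sineMode, this, Real.sin_int_mul_pi]
  have hprev : (if a - 1 ∈ Finset.Icc (0 : ℤ) (N - 1) then sineMode N (a - 1) k else 0)
      = sineMode N (a - 1) k := by
    split_ifs with h
    · rfl
    · have : a - 1 = -1 := by simp only [Finset.mem_Icc] at h ha; omega
      rw [this, hleft]
  have hnext : (if a + 1 ∈ Finset.Icc (0 : ℤ) (N - 1) then sineMode N (a + 1) k else 0)
      = sineMode N (a + 1) k := by
    split_ifs with h
    · rfl
    · have : a + 1 = N := by simp only [Finset.mem_Icc] at h ha; omega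
      rw [this, hright]
  simp only [lapKernel, sub_mul, ite_mul, zero_mul, one_mul, Finset.sum_sub_distrib,
    Finset.sum_ite_eq', hprev, hnext, if_pos ha]
  have e1 : (((a - 1 : ℤ) : ℝ) + 1) * modeFreq N k
      = ((a : ℝ) + 1) * modeFreq N k - modeFreq N k := by push_cast; ring
  have e2 : (((a + 1 : ℤ) : ℝ) + 1) * modeFreq N k
      = ((a : ℝ) + 1) * modeFreq N k + modeFreq N k := by push_cast; ring
  simp only [sineMode, modeEigenvalue, e1, e2, Real.sin_sub, Real.sin_add]
  ring

lemma modeEigenvalue_injOn (N : ℕ) :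
    Set.InjOn (modeEigenvalue N) (Finset.Icc (0 : ℤ) (N - 1)) := by
  intro k hk l hl h
  have hcos : Real.cos (modeFreq N k) = Real.cos (modeFreq N l) := by
    unfold modeEigenvalue at h; linarith
  have hfreq := Real.injOn_cos (Set.Ioo_subset_Icc_self (modeFreq_mem_Ioo hk))
    (Set.Ioo_subset_Icc_self (modeFreq_mem_Ioo hl)) hcos
  unfold modeFreq at hfreq
  have hpi := Real.pi_pos
  field_simp at hfreq
  have : (k : ℝ) = l := by linarith
  exact_mod_cast this

lemma sum_sineMode_mul_sineMode_of_ne {N : ℕ} {k l : ℤ}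
    (hk : k ∈ Finset.Icc (0 : ℤ) (N - 1)) (hl : l ∈ Finset.Icc (0 : ℤ) (N - 1)) (hkl : k ≠ l) :
    ∑ a ∈ Finset.Icc (0 : ℤ) (N - 1), sineMode N a k * sineMode N a l = 0 := by
  have key : modeEigenvalue N k * ∑ a ∈ Finset.Icc (0 : ℤ) (N - 1), sineMode N a k * sineMode N a l
      = modeEigenvalue N l * ∑ a ∈ Finset.Icc (0 : ℤ) (N - 1), sineMode N a k * sineMode N a l := by
    calc _ = ∑ a ∈ Finset.Icc (0 : ℤ) (N - 1), ∑ b ∈ Finset.Icc (0 : ℤ) (N - 1),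
          lapKernel a b * sineMode N b k * sineMode N a l := by
          rw [Finset.mul_sum]
          refine Finset.sum_congr rfl fun a ha => ?_
          rw [← mul_assoc, ← sum_lapKernel_mul_sineMode k ha, Finset.sum_mul]
      _ = ∑ b ∈ Finset.Icc (0 : ℤ) (N - 1), ∑ a ∈ Finset.Icc (0 : ℤ) (N - 1),
          lapKernel a b * sineMode N b k * sineMode N a l := Finset.sum_comm
      _ = _ := by
          rw [Finset.mul_sum]
          refine Finset.sum_congr rfl fun b hb => ?_
          rw [mul_left_comm, ← sum_lapKernel_mul_sineMode l hb, Finset.mul_sum]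
          refine Finset.sum_congr rfl fun a _ => ?_
          rw [lapKernel_comm]
          ring
  by_contra hne
  exact hkl (modeEigenvalue_injOn N hk hl (mul_right_cancel₀ hne key))

lemma sum_sineMode_mul_self_pos {N : ℕ} {k : ℤ} (hk : k ∈ Finset.Icc (0 : ℤ) (N - 1)) :
    0 < ∑ a ∈ Finset.Icc (0 : ℤ) (N - 1), sineMode N a k * sineMode N a k := by
  refine Finset.sum_pos' (fun a _ => mul_self_nonneg _) ⟨0, ?_, ?_⟩
  · simp only [Finset.mem_Icc] at hk ⊢; omega
  · have : 0 < sineMode N 0 k := by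
      obtain ⟨h0, h1⟩ := modeFreq_mem_Ioo hk
      simpa [sineMode] using Real.sin_pos_of_pos_of_lt_pi h0 h1
    positivity

lemma modeEigenvalue_pos {N : ℕ} {k : ℤ} (hk : k ∈ Finset.Icc (0 : ℤ) (N - 1)) :
    0 < modeEigenvalue N k := by
  obtain ⟨h0, h1⟩ := modeFreq_mem_Ioo hk
  have := Real.cos_lt_cos_of_nonneg_of_le_pi le_rfl h1.le h0
  rw [Real.cos_zero] at this
  unfold modeEigenvalue
  linarith

lemma modeEigenvalue_le (N : ℕ) (k : ℤ) : modeEigenvalue N k ≤ modeFreq N k ^ 2 := by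
  have := Real.one_sub_sq_div_two_le_cos (x := modeFreq N k)
  unfold modeEigenvalue
  linarith

/-- The product of one-dimensional Dirichlet modes. -/
def boxMode (d N : ℕ) (x k : Site d) : ℝ := ∏ i, sineMode N (x i) (k i)

/-- The eigenvalue of `boxMode`. -/
def boxEigenvalue (d N : ℕ) (k : Site d) : ℝ := ∑ i, modeEigenvalue N (k i)

lemma mem_latBox {d : ℕ} {a b : ℤ} {x : Site d} :
    x ∈ latBox d a b ↔ ∀ i, x i ∈ Finset.Icc a b := by
  simp [latBox]

/-- The Dirichlet Laplacian is a Kronecker sum of one-dimensional Laplacians. -/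
lemma dirLap_apply_eq_sum_prod (d : ℕ) (Λ : Finset (Site d)) (x y : Λ) :
    dirLap d Λ x y = ∑ i, ∏ j, if j = i then lapKernel (x.1 j) (y.1 j)
      else if y.1 j = x.1 j then 1 else 0 := by
  obtain ⟨x, hx⟩ := x
  obtain ⟨y, hy⟩ := y
  simp only [dirLap]
  split_ifs with hxy hdist
  · subst hxy
    simp [lapKernel_self, Finset.prod_ite_eq', mul_comm]
  all_goals
    obtain ⟨i, hi⟩ := Function.ne_iff.mp hxy
    have hzero : ∀ l ∈ Finset.univ, l ≠ i → (∏ j, if j = l then lapKernel (x j) (y j)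
        else if y j = x j then 1 else 0) = (0 : ℝ) := by
      intro l _ hl
      refine Finset.prod_eq_zero (Finset.mem_univ i) ?_
      rw [if_neg (Ne.symm hl), if_neg (Ne.symm hi)]
    rw [Finset.sum_eq_single i hzero (by simp)]
    by_cases hother : ∃ j, j ≠ i ∧ x j ≠ y j
    · obtain ⟨j, hji, hj⟩ := hother
      have h2 : |x i - y i| + |x j - y j| ≤ l1dist x y := by
        rw [← Finset.sum_pair (f := fun i => |x i - y i|) (Ne.symm hji)]
        exact Finset.sum_le_sum_of_subset_of_nonneg (Finset.subset_univ _)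
          fun _ _ _ => abs_nonneg _
      have hi' := Int.one_le_abs (sub_ne_zero.mpr hi)
      have hj' := Int.one_le_abs (sub_ne_zero.mpr hj)
      first
        | omega
        | symm
          refine Finset.prod_eq_zero (Finset.mem_univ j) ?_
          rw [if_neg hji, if_neg (Ne.symm hj)]
    · push Not at hother
      have hl1 : l1dist x y = |x i - y i| := by
        refine Finset.sum_eq_single i (fun j _ hj => ?_) (by simp)
        rw [hother j hj, sub_self, abs_zero]
      rw [Finset.prod_eq_single i (fun j _ hj => by rw [if_neg hj, if_pos (hother j hj).symm])
        (by simp), if_pos rfl, lapKernel_of_ne hi, ← hl1]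
      simp [hdist]

lemma sum_dirLap_mul_boxMode {d N : ℕ} (x : (latBox d 0 ((N : ℤ) - 1) : Finset (Site d)))
    (k : Site d) :
    ∑ y : (latBox d 0 ((N : ℤ) - 1) : Finset (Site d)),
      dirLap d (latBox d 0 ((N : ℤ) - 1)) x y * boxMode d N y k
      = boxEigenvalue d N k * boxMode d N x k := by
  obtain ⟨x, hx⟩ := x
  simp only [dirLap_apply_eq_sum_prod]
  rw [Finset.sum_coe_sort (latBox d 0 ((N : ℤ) - 1)) fun y : Site d =>
    (∑ i, ∏ j, if j = i then lapKernel (x j) (y j) else if y j = x j then 1 else 0)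
      * boxMode d N y k]
  simp only [Finset.sum_mul, boxMode, boxEigenvalue, ← Finset.prod_mul_distrib]
  rw [Finset.sum_comm]
  refine Finset.sum_congr rfl fun i _ => ?_
  rw [latBox, ← Finset.prod_univ_sum (fun _ => Finset.Icc (0 : ℤ) (N - 1)) fun j b =>
    (if j = i then lapKernel (x j) b else if b = x j then 1 else 0) * sineMode N b (k j)]
  have hfactor : ∀ j, (∑ b ∈ Finset.Icc (0 : ℤ) (N - 1),
      (if j = i then lapKernel (x j) b else if b = x j then 1 else 0) * sineMode N b (k j))
      = (if j = i then modeEigenvalue N (k j) else 1) * sineMode N (x j) (k j) := by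
    intro j
    have hj := mem_latBox.mp hx j
    split_ifs with h
    · exact sum_lapKernel_mul_sineMode (k j) hj
    · simp only [ite_mul, one_mul, zero_mul, Finset.sum_ite_eq', if_pos hj]
  simp only [hfactor, Finset.prod_mul_distrib, Finset.prod_ite_eq', Finset.mem_univ, if_true]

lemma sum_boxMode_mul_boxMode (d N : ℕ) (k l : Site d) :
    ∑ x : (latBox d 0 ((N : ℤ) - 1) : Finset (Site d)), boxMode d N x k * boxMode d N x l
      = ∏ i, ∑ a ∈ Finset.Icc (0 : ℤ) (N - 1), sineMode N a (k i) * sineMode N a (l i) := by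
  rw [Finset.sum_coe_sort (latBox d 0 ((N : ℤ) - 1)) fun x : Site d =>
    boxMode d N x k * boxMode d N x l]
  simp only [boxMode, ← Finset.prod_mul_distrib]
  rw [Finset.prod_univ_sum, latBox]

/-- The matrix whose columns are the Dirichlet modes of the box. -/
def boxModeMatrix (d N : ℕ) :
    Matrix (latBox d 0 ((N : ℤ) - 1) : Finset (Site d))
      (latBox d 0 ((N : ℤ) - 1) : Finset (Site d)) ℝ :=
  Matrix.of fun x k => boxMode d N x k

lemma isUnit_det_boxModeMatrix (d N : ℕ) : IsUnit (boxModeMatrix d N).det := by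
  have hgram : (boxModeMatrix d N).transpose * boxModeMatrix d N = Matrix.diagonal fun k =>
      ∏ i, ∑ a ∈ Finset.Icc (0 : ℤ) (N - 1), sineMode N a (k.1 i) * sineMode N a (k.1 i) := by
    ext k l
    rw [Matrix.mul_apply]
    simp only [Matrix.transpose_apply, boxModeMatrix, Matrix.of_apply]
    rw [sum_boxMode_mul_boxMode]
    by_cases h : k = l
    · subst h
      rw [Matrix.diagonal_apply_eq]
    · rw [Matrix.diagonal_apply_ne _ h]
      obtain ⟨i, hi⟩ := Function.ne_iff.mp fun h' => h (Subtype.ext h')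
      exact Finset.prod_eq_zero (Finset.mem_univ i)
        (sum_sineMode_mul_sineMode_of_ne (mem_latBox.mp k.2 i) (mem_latBox.mp l.2 i) hi)
  have hdet := congrArg Matrix.det hgram
  rw [Matrix.det_mul, Matrix.det_diagonal] at hdet
  refine isUnit_iff_ne_zero.mpr (right_ne_zero_of_mul (a := (boxModeMatrix d N).transpose.det) ?_)
  rw [hdet]
  exact (Finset.prod_pos fun k _ => Finset.prod_pos fun i _ =>
    sum_sineMode_mul_self_pos (mem_latBox.mp k.2 i)).ne'

lemma boxEigenvalue_pos {d N : ℕ} (hd : 0 < d) {k : Site d}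
    (hk : k ∈ latBox d 0 ((N : ℤ) - 1)) : 0 < boxEigenvalue d N k :=
  Finset.sum_pos (fun i _ => modeEigenvalue_pos (mem_latBox.mp hk i)) ⟨⟨0, hd⟩, Finset.mem_univ _⟩

lemma trace_inv_sq_dirLap_latBox {d : ℕ} (hd : 0 < d) (N : ℕ) :
    ∑ x : (latBox d 0 ((N : ℤ) - 1) : Finset (Site d)),
      ((dirLap d (latBox d 0 ((N : ℤ) - 1)))⁻¹ * (dirLap d (latBox d 0 ((N : ℤ) - 1)))⁻¹) x x
      = ∑ k ∈ latBox d 0 ((N : ℤ) - 1), (boxEigenvalue d N k ^ 2)⁻¹ := by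
  rw [← Finset.sum_coe_sort (latBox d 0 ((N : ℤ) - 1))]
  have hdiag : dirLap d (latBox d 0 ((N : ℤ) - 1)) * boxModeMatrix d N
      = boxModeMatrix d N * Matrix.diagonal fun k => boxEigenvalue d N k.1 := by
    ext x k
    rw [Matrix.mul_diagonal, Matrix.mul_apply, mul_comm]
    exact sum_dirLap_mul_boxMode x k
  exact trace_inv_mul_inv_of_mul_eq_mul_diagonal (isUnit_det_boxModeMatrix d N) hdiag
    fun k => (boxEigenvalue_pos hd k.2).ne'

lemma boxEigenvalue_le {d N : ℕ} {k : Site d} {m : ℕ} (hk : ∀ i, k i ∈ Finset.Icc (0 : ℤ) m) :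
    boxEigenvalue d N k ≤ d * (Real.pi * (m + 1) / (N + 1)) ^ 2 := by
  have hterm : ∀ i ∈ Finset.univ, modeEigenvalue N (k i) ≤ (Real.pi * (m + 1) / (N + 1)) ^ 2 := by
    intro i _
    refine (modeEigenvalue_le N (k i)).trans ?_
    obtain ⟨h0, h1⟩ := Finset.mem_Icc.mp (hk i)
    have h0' : (0 : ℝ) ≤ k i := by exact_mod_cast h0
    have h1' : (k i : ℝ) ≤ m := by exact_mod_cast h1
    have hpi := Real.pi_pos
    unfold modeFreq
    gcongr
  simpa [boxEigenvalue] using Finset.sum_le_card_nsmul _ _ _ hterm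

/-- The sites of `{0,…,m}^d` whose zeroth coordinate is `m`. -/
def boxFace (d : ℕ) [NeZero d] (m : ℕ) : Finset (Site d) :=
  Fintype.piFinset fun i => if i = 0 then {(m : ℤ)} else Finset.Icc 0 (m : ℤ)

lemma mem_boxFace {d : ℕ} [NeZero d] {m : ℕ} {k : Site d} (hk : k ∈ boxFace d m) :
    k 0 = m ∧ ∀ i, k i ∈ Finset.Icc (0 : ℤ) m := by
  rw [boxFace, Fintype.mem_piFinset] at hk
  have h0 : k 0 = m := by simpa using hk 0
  refine ⟨h0, fun i => ?_⟩
  by_cases hi : i = 0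
  · subst hi; simp [h0]
  · simpa [hi] using hk i

lemma card_boxFace (d : ℕ) [NeZero d] (m : ℕ) : (boxFace d m).card = (m + 1) ^ (d - 1) := by
  rw [boxFace, Fintype.card_piFinset, ← Finset.mul_prod_erase _ _ (Finset.mem_univ 0), if_pos rfl,
    Finset.prod_congr rfl (g := fun _ => m + 1) (fun i hi => by
      rw [if_neg (Finset.ne_of_mem_erase hi)]; simp)]
  simp

lemma sum_boxFace_le_sum_latBox (d N : ℕ) [NeZero d] {f : Site d → ℝ} (hf : ∀ k, 0 ≤ f k) :
    ∑ m ∈ Finset.range N, ∑ k ∈ boxFace d m, f k ≤ ∑ k ∈ latBox d 0 ((N : ℤ) - 1), f k := by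
  rw [← Finset.sum_biUnion]
  · refine Finset.sum_le_sum_of_subset_of_nonneg (fun k hk => ?_) fun k _ _ => hf k
    obtain ⟨m, hm, hk⟩ := Finset.mem_biUnion.mp hk
    refine mem_latBox.mpr fun i => ?_
    have hi := (mem_boxFace hk).2 i
    simp only [Finset.mem_Icc, Finset.mem_range] at hi hm ⊢
    omega
  · intro m _ n _ hmn
    refine Finset.disjoint_left.mpr fun k hm hn => hmn ?_
    exact_mod_cast (mem_boxFace hm).1.symm.trans (mem_boxFace hn).1

lemma inv_le_sum_boxFace_div {d N m : ℕ} [NeZero d] (hd : d ≤ 4) (hm : m < N) :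
    ((d : ℝ) ^ 2 * Real.pi ^ 4)⁻¹ * (1 / ((m : ℝ) + 1))
      ≤ (∑ k ∈ boxFace d m, (boxEigenvalue d N k ^ 2)⁻¹) / (N : ℝ) ^ d := by
  have hd0 : 0 < d := Nat.pos_of_neZero d
  have hdR : (0 : ℝ) < d := by exact_mod_cast hd0
  have hN : (0 : ℝ) < N := by exact_mod_cast (Nat.zero_le m).trans_lt hm
  have hmN : (m : ℝ) + 1 ≤ N := by exact_mod_cast hm
  have hpi := Real.pi_pos
  set L : ℝ := d * (Real.pi * (m + 1) / (N + 1)) ^ 2 with hL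
  have hterm : ∀ k ∈ boxFace d m, (L ^ 2)⁻¹ ≤ (boxEigenvalue d N k ^ 2)⁻¹ := by
    intro k hk
    have hk' := (mem_boxFace hk).2
    have hpos : 0 < boxEigenvalue d N k := boxEigenvalue_pos hd0 <| mem_latBox.mpr fun i => by
      have hi := hk' i
      simp only [Finset.mem_Icc] at hi ⊢
      omega
    have hle := boxEigenvalue_le (N := N) hk'
    gcongr
  have hsum := Finset.card_nsmul_le_sum _ _ _ hterm
  rw [card_boxFace, nsmul_eq_mul] at hsum
  push_cast at hsum
  rw [le_div_iff₀ (by positivity)]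
  refine le_trans ?_ hsum
  have hpow : ((m : ℝ) + 1) ^ 4 * (N : ℝ) ^ d ≤ ((m : ℝ) + 1) ^ d * ((N : ℝ) + 1) ^ 4 := by
    calc ((m : ℝ) + 1) ^ 4 * (N : ℝ) ^ d
        = ((m : ℝ) + 1) ^ d * (((m : ℝ) + 1) ^ (4 - d) * (N : ℝ) ^ d) := by
          rw [← mul_assoc, ← pow_add, Nat.add_sub_cancel' hd]
      _ ≤ ((m : ℝ) + 1) ^ d * ((N : ℝ) ^ (4 - d) * (N : ℝ) ^ d) := by gcongr
      _ = ((m : ℝ) + 1) ^ d * (N : ℝ) ^ 4 := by rw [← pow_add, Nat.sub_add_cancel hd]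
      _ ≤ _ := by gcongr; linarith
  have hsucc : ((m : ℝ) + 1) ^ d = ((m : ℝ) + 1) ^ (d - 1) * (m + 1) := by
    rw [← pow_succ, Nat.sub_add_cancel hd0]
  rw [hsucc] at hpow
  calc ((d : ℝ) ^ 2 * Real.pi ^ 4)⁻¹ * (1 / ((m : ℝ) + 1)) * (N : ℝ) ^ d
      = (((m : ℝ) + 1) ^ 4 * (N : ℝ) ^ d) * ((d : ℝ) ^ 2 * Real.pi ^ 4 * (m + 1) ^ 5)⁻¹ := by
        field_simp
    _ ≤ (((m : ℝ) + 1) ^ (d - 1) * (m + 1) * ((N : ℝ) + 1) ^ 4)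
          * ((d : ℝ) ^ 2 * Real.pi ^ 4 * (m + 1) ^ 5)⁻¹ := by gcongr
    _ = ((m : ℝ) + 1) ^ (d - 1) * (L ^ 2)⁻¹ := by
        rw [hL]
        field_simp

/-- For `d ∈ {2,3,4}`, the per-site trace of the squared inverse Dirichlet
Laplacian on the box `Λ_N = {0,…,N−1}^d` diverges as `N → ∞`. -/
theorem perSite_trace_inv_sq_dirLap_tendsto_atTop (d : ℕ) (hd : d = 2 ∨ d = 3 ∨ d = 4) :
    Tendsto
      (fun N : ℕ =>
        (∑ x : (latBox d 0 ((N : ℤ) - 1) : Finset (Site d)),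
            ((dirLap d (latBox d 0 ((N : ℤ) - 1)))⁻¹ *
              (dirLap d (latBox d 0 ((N : ℤ) - 1)))⁻¹) x x) / (N : ℝ) ^ d)
      atTop atTop := by
  have hd0 : 0 < d := by omega
  have : NeZero d := ⟨hd0.ne'⟩
  have hc : 0 < ((d : ℝ) ^ 2 * Real.pi ^ 4)⁻¹ := by
    have : (0 : ℝ) < d := by exact_mod_cast hd0
    have := Real.pi_pos
    positivity
  refine tendsto_atTop_mono (fun N => ?_)
    (Real.tendsto_sum_range_one_div_nat_succ_atTop.const_mul_atTop hc)
  rw [trace_inv_sq_dirLap_latBox hd0, Finset.mul_sum]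
  calc _ ≤ ∑ m ∈ Finset.range N,
        (∑ k ∈ boxFace d m, (boxEigenvalue d N k ^ 2)⁻¹) / (N : ℝ) ^ d :=
        Finset.sum_le_sum fun m hm => inv_le_sum_boxFace_div (by omega) (Finset.mem_range.mp hm)
    _ ≤ _ := by
        rw [← Finset.sum_div]
        gcongr
        exact sum_boxFace_le_sum_latBox d N fun k => by positivity

end
end

section
/- Let Q_ℓ = {1,…,ℓ}^d with nearest-neighbor edges, let L be its graph Laplacian, let (α_x)_{x∈Q_ℓ} be i.i.d. standard real Gaussians, set α̂_x = α_x − ℓ^{-d} Σ_z α_z, and let E_{Q_ℓ}(α) = Σ_x α̂_x g_x where g is the unique mean-zero solution of Lg = α̂. Then there are constants 0 < c ≤ C such that for all ℓ ≥ 2: if d = 2, c ℓ² log ℓ ≤ E[E_{Q_ℓ}(α)] ≤ C ℓ² log ℓ; and if d ≥ 3, c ℓ^d ≤ E[E_{Q_ℓ}(α)] ≤ C ℓ^d. (This identifies the typical order of magnitude of the disorder energy (ε²/2)cos²(ψ) E_{Q_ℓ}(α) gained on a box of side ℓ: ε²ℓ²log ℓ in d = 2 and ε²ℓ^d in d ≥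 3.) -/
open scoped Classical BigOperators
open MeasureTheory

noncomputable section

/-- The box `Q_ℓ = {1,…,ℓ}^d` as a Finset of `ℤ^d`. -/
def boxQ (d : ℕ) (ℓ : ℕ) : Finset (Site d) := Fintype.piFinset fun _ => Finset.Icc 1 (ℓ : ℤ)

/-- The graph Laplacian of the box `Q_ℓ` with nearest-neighbor edges:
`(Lθ)_x = Σ_{y∼x} (θ_x − θ_y)`, i.e. degree on the diagonal and `−1` between neighbors. -/
def boxLap (d : ℕ) (ℓ : ℕ) : Matrix (boxQ d ℓ) (boxQ d ℓ) ℝ := fun x y =>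
  if (x : Site d) = (y : Site d) then
    (((boxQ d ℓ).filter fun z => l1dist z (x : Site d) = 1).card : ℝ)
  else if l1dist (x : Site d) (y : Site d) = 1 then -1 else 0

/-- The centered disorder `α̂_x = α_x − ℓ^{-d} Σ_z α_z`. -/
def centered (d ℓ : ℕ) (α : boxQ d ℓ → ℝ) : boxQ d ℓ → ℝ :=
  fun x => α x - (∑ z, α z) / (ℓ : ℝ) ^ d

/-- The i.i.d. standard Gaussian disorder distribution on `ℝ^{Q_ℓ}`. -/
def disorderP (d ℓ : ℕ) : Measure (boxQ d ℓ → ℝ) :=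
  Measure.pi fun _ => ProbabilityTheory.gaussianReal 0 1

/-- The `k`-th Neumann eigenfunction of the path `{1,…,ℓ}`. -/
def pathCos (ℓ k : ℕ) (t : ℤ) : ℝ := Real.cos (Real.pi * k / ℓ * (t - 1 / 2))

/-- The eigenvalue of the path Laplacian belonging to `pathCos ℓ k`. -/
def pathEig (ℓ k : ℕ) : ℝ := 2 * (1 - Real.cos (Real.pi * k / ℓ))

theorem pathCos_zero_site (ℓ k : ℕ) : pathCos ℓ k 0 = pathCos ℓ k 1 := by
  unfold pathCos
  rw [← Real.cos_neg]
  congr 1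
  push_cast
  ring

theorem pathCos_reflect_end {ℓ : ℕ} (hℓ : 0 < ℓ) (k : ℕ) :
    pathCos ℓ k (ℓ + 1) = pathCos ℓ k ℓ := by
  have h0 : (ℓ : ℝ) ≠ 0 := by positivity
  unfold pathCos
  have h1 : Real.pi * k / ℓ * (((ℓ : ℤ) + 1 : ℤ) - 1 / 2 : ℝ)
      = k * Real.pi + Real.pi * k / ℓ * (1 / 2) := by
    push_cast; field_simp; ring
  have h2 : Real.pi * k / ℓ * (((ℓ : ℤ) : ℝ) - 1 / 2)
      = k * Real.pi - Real.pi * k / ℓ * (1 / 2) := by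
    push_cast; field_simp
  rw [h1, h2, Real.cos_add, Real.cos_sub, Real.sin_nat_mul_pi]
  ring

theorem pathCos_add_pathCos (ℓ k : ℕ) (t : ℤ) :
    pathCos ℓ k (t - 1) + pathCos ℓ k (t + 1)
      = 2 * Real.cos (Real.pi * k / ℓ) * pathCos ℓ k t := by
  unfold pathCos
  have h1 : Real.pi * k / ℓ * (((t - 1 : ℤ) : ℝ) - 1 / 2)
      = Real.pi * k / ℓ * (t - 1 / 2) - Real.pi * k / ℓ := by push_cast; ring
  have h2 : Real.pi * k / ℓ * (((t + 1 : ℤ) : ℝ) - 1 / 2)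
      = Real.pi * k / ℓ * (t - 1 / 2) + Real.pi * k / ℓ := by push_cast; ring
  rw [h1, h2, Real.cos_add, Real.cos_sub]
  ring

theorem sum_pathCos_sub {ℓ k : ℕ} {t : ℤ} (ht : t ∈ Finset.Icc 1 (ℓ : ℤ)) :
    ∑ s ∈ (Finset.Icc 1 (ℓ : ℤ)).filter (fun s => |s - t| = 1), (pathCos ℓ k t - pathCos ℓ k s)
      = pathEig ℓ k * pathCos ℓ k t := by
  rw [Finset.mem_Icc] at ht
  have hsub : (Finset.Icc 1 (ℓ : ℤ)).filter (fun s => |s - t| = 1) ⊆ {t - 1, t + 1} := by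
    intro s hs
    simp only [Finset.mem_filter, Finset.mem_Icc, Finset.mem_insert, Finset.mem_singleton] at hs ⊢
    rcases abs_eq (by norm_num : (0 : ℤ) ≤ 1) |>.1 hs.2 with h | h <;> omega
  rw [Finset.sum_subset hsub, Finset.sum_pair (by omega)]
  · have := pathCos_add_pathCos ℓ k t
    unfold pathEig
    linarith
  · intro s hs hs'
    simp only [Finset.mem_insert, Finset.mem_singleton, Finset.mem_filter, Finset.mem_Icc,
      not_and] at hs hs'
    rcases hs with rfl | rfl
    · have : t = 1 := by
        by_contra hne
        exact hs' ⟨by omega, by omega⟩ (by simp)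
      subst this
      simp [pathCos_zero_site]
    · have : t = ℓ := by
        by_contra hne
        exact hs' ⟨by omega, by omega⟩ (by simp)
      subst this
      rw [pathCos_reflect_end (by omega), sub_self]

theorem pathEig_injOn {ℓ j k : ℕ} (hj : j < ℓ) (hk : k < ℓ) (h : pathEig ℓ j = pathEig ℓ k) :
    j = k := by
  have h0 : (0 : ℝ) < ℓ := by exact_mod_cast (by omega : 0 < ℓ)
  have mem : ∀ i : ℕ, i < ℓ → Real.pi * i / ℓ ∈ Set.Icc 0 Real.pi := by
    intro i hi
    refine ⟨by positivity, ?_⟩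
    rw [div_le_iff₀ h0]
    have : (i : ℝ) ≤ ℓ := by exact_mod_cast hi.le
    gcongr
  have h1 := Real.injOn_cos (mem j hj) (mem k hk) (by unfold pathEig at h; linarith)
  field_simp at h1
  exact_mod_cast h1

theorem sum_pathCos_mul_pathCos {ℓ j k : ℕ} (hj : j < ℓ) (hk : k < ℓ) (hjk : j ≠ k) :
    ∑ t ∈ Finset.Icc 1 (ℓ : ℤ), pathCos ℓ j t * pathCos ℓ k t = 0 := by
  have key : ∀ a b : ℕ, pathEig ℓ a * ∑ t ∈ Finset.Icc 1 (ℓ : ℤ), pathCos ℓ a t * pathCos ℓ b t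
      = ∑ t ∈ Finset.Icc 1 (ℓ : ℤ), ∑ s ∈ Finset.Icc 1 (ℓ : ℤ),
        if |s - t| = 1 then (pathCos ℓ a t - pathCos ℓ a s) * pathCos ℓ b t else 0 := by
    intro a b
    rw [Finset.mul_sum]
    refine Finset.sum_congr rfl fun t ht => ?_
    rw [← mul_assoc, ← sum_pathCos_sub ht, Finset.sum_mul, Finset.sum_filter]
  have h1 : pathEig ℓ j * ∑ t ∈ Finset.Icc 1 (ℓ : ℤ), pathCos ℓ j t * pathCos ℓ k t
      = pathEig ℓ k * ∑ t ∈ Finset.Icc 1 (ℓ : ℤ), pathCos ℓ k t * pathCos ℓ j t := by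
    have h3 : ∑ t ∈ Finset.Icc 1 (ℓ : ℤ), ∑ s ∈ Finset.Icc 1 (ℓ : ℤ),
          (if |s - t| = 1 then pathCos ℓ j s * pathCos ℓ k t else 0)
        = ∑ t ∈ Finset.Icc 1 (ℓ : ℤ), ∑ s ∈ Finset.Icc 1 (ℓ : ℤ),
          (if |s - t| = 1 then pathCos ℓ k s * pathCos ℓ j t else 0) := by
      rw [Finset.sum_comm]
      refine Finset.sum_congr rfl fun t _ => Finset.sum_congr rfl fun s _ => ?_
      rw [abs_sub_comm, mul_comm]
    rw [key, key, ← sub_eq_zero]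
    rw [← sub_eq_zero] at h3
    simp only [← Finset.sum_sub_distrib] at h3 ⊢
    rw [← neg_eq_zero, ← h3]
    simp only [← Finset.sum_neg_distrib]
    refine Finset.sum_congr rfl fun t _ => Finset.sum_congr rfl fun s _ => ?_
    split_ifs <;> ring
  simp_rw [mul_comm (pathCos ℓ k _)] at h1
  by_contra hne
  exact hjk (pathEig_injOn hj hk (mul_right_cancel₀ hne h1))

/-- The squared norm of `pathCos ℓ k` on `{1,…,ℓ}`. -/
def pathNormSq (ℓ k : ℕ) : ℝ := ∑ t ∈ Finset.Icc 1 (ℓ : ℤ), pathCos ℓ k t * pathCos ℓ k t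

theorem pathNormSq_pos {ℓ k : ℕ} (hk : k < ℓ) : 0 < pathNormSq ℓ k := by
  refine Finset.sum_pos' (fun t _ => mul_self_nonneg _) ⟨1, by simp; omega, ?_⟩
  have h0 : (0 : ℝ) < ℓ := by exact_mod_cast (by omega : 0 < ℓ)
  have : 0 < pathCos ℓ k 1 := by
    refine Real.cos_pos_of_mem_Ioo ⟨?_, ?_⟩
    · have : 0 ≤ Real.pi * k / ℓ * (((1 : ℤ) : ℝ) - 1 / 2) := by
        push_cast; norm_num; positivity
      linarith [Real.pi_pos]
    · have h1 : (k : ℝ) < ℓ := by exact_mod_cast hk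
      have h2 : Real.pi * k / ℓ < Real.pi := by
        rw [div_lt_iff₀ h0]; exact mul_lt_mul_of_pos_left h1 Real.pi_pos
      push_cast; linarith
  positivity

/-- The normalized Neumann eigenfunctions of the box, indexed by frequency and site. -/
def boxModes (d ℓ : ℕ) : Matrix (Fin d → Fin ℓ) (boxQ d ℓ) ℝ := fun k x =>
  ∏ i, pathCos ℓ (k i) ((x : Site d) i) / √(pathNormSq ℓ (k i))

/-- The eigenvalue of the box Laplacian at frequency `k`. -/
def boxEig {d ℓ : ℕ} (k : Fin d → Fin ℓ) : ℝ := ∑ i, pathEig ℓ (k i)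

theorem boxModes_mul_transpose (d ℓ : ℕ) : boxModes d ℓ * (boxModes d ℓ).transpose = 1 := by
  ext j k
  rw [Matrix.mul_apply]
  simp only [Matrix.transpose_apply, boxModes, ← Finset.prod_mul_distrib]
  rw [Finset.sum_coe_sort (boxQ d ℓ) (fun x : Site d =>
    ∏ i, pathCos ℓ (j i) (x i) / √(pathNormSq ℓ (j i)) *
      (pathCos ℓ (k i) (x i) / √(pathNormSq ℓ (k i)))), boxQ,
    ← Finset.prod_univ_sum (fun _ : Fin d => Finset.Icc 1 (ℓ : ℤ)) (fun i t =>
      pathCos ℓ (j i) t / √(pathNormSq ℓ (j i)) * (pathCos ℓ (k i) t / √(pathNormSq ℓ (k i))))]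
  have h : ∀ i, ∑ t ∈ Finset.Icc 1 (ℓ : ℤ), pathCos ℓ (j i) t / √(pathNormSq ℓ (j i)) *
      (pathCos ℓ (k i) t / √(pathNormSq ℓ (k i))) = if j i = k i then 1 else 0 := by
    intro i
    simp_rw [div_mul_div_comm, ← Finset.sum_div]
    split_ifs with hi
    · have hp := pathNormSq_pos (k i).2
      rw [hi, Real.mul_self_sqrt hp.le]
      exact div_self hp.ne'
    · rw [sum_pathCos_mul_pathCos (j i).2 (k i).2 (fun h => hi (Fin.ext h)), zero_div]
  simp_rw [h]
  rw [Finset.prod_ite_zero, Matrix.one_apply]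
  simp [funext_iff]

theorem card_boxQ (d ℓ : ℕ) : (boxQ d ℓ).card = ℓ ^ d := by
  simp [boxQ]

theorem boxModes_transpose_mul (d ℓ : ℕ) : (boxModes d ℓ).transpose * boxModes d ℓ = 1 :=
  (Matrix.mul_eq_one_comm_of_card_eq _ _ _ (by simp [card_boxQ])).1 (boxModes_mul_transpose d ℓ)

theorem l1dist_comm {d : ℕ} (x y : Site d) : l1dist x y = l1dist y x := by
  simp only [l1dist, abs_sub_comm]

theorem l1dist_update {d : ℕ} (x : Site d) (i : Fin d) (s : ℤ) :
    l1dist (Function.update x i s) x = |s - x i| := by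
  rw [l1dist, Finset.sum_eq_single i]
  · simp
  · intro j _ hj
    simp [Function.update_of_ne hj]
  · simp

theorem exists_eq_update_of_l1dist_eq_one {d : ℕ} {x z : Site d} (h : l1dist z x = 1) :
    ∃ i, z = Function.update x i (z i) := by
  obtain ⟨i, hi⟩ : ∃ i, z i ≠ x i := by
    by_contra! hall
    simp [l1dist, hall] at h
  refine ⟨i, funext fun j => ?_⟩
  by_cases hj : j = i
  · subst hj; simp
  rw [Function.update_of_ne hj]
  have h1 : |z i - x i| + |z j - x j| ≤ 1 := by
    rw [← h, l1dist, ← Finset.sum_pair (f := fun i => |z i - x i|) (Ne.symm hj)]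
    exact Finset.sum_le_sum_of_subset_of_nonneg (Finset.subset_univ _) fun _ _ _ => abs_nonneg _
  have h2 : 0 < |z i - x i| := abs_pos.2 (sub_ne_zero.2 hi)
  have h3 : |z j - x j| = 0 := by have := abs_nonneg (z j - x j); omega
  linarith [abs_eq_zero.1 h3]

theorem sum_neighbors {d ℓ : ℕ} {x : Site d} (hx : x ∈ boxQ d ℓ) (h : Site d → ℝ) :
    ∑ z ∈ (boxQ d ℓ).filter (fun z => l1dist z x = 1), h z
      = ∑ i, ∑ s ∈ (Finset.Icc 1 (ℓ : ℤ)).filter (fun s => |s - x i| = 1),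
          h (Function.update x i s) := by
  rw [Finset.sum_sigma']
  symm
  refine Finset.sum_bij (fun p _ => Function.update x p.1 p.2) ?_ ?_ ?_ ?_
  · rintro ⟨i, s⟩ hp
    simp only [Finset.mem_sigma, Finset.mem_univ, true_and, Finset.mem_filter] at hp
    rw [Finset.mem_filter, l1dist_update]
    refine ⟨?_, hp.2⟩
    rw [boxQ, Fintype.mem_piFinset] at hx ⊢
    intro j
    by_cases hj : j = i
    · subst hj; simpa using hp.1
    · rw [Function.update_of_ne hj]; exact hx j
  · rintro ⟨i, s⟩ hp ⟨j, r⟩ hq heq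
    simp only [Finset.mem_sigma, Finset.mem_univ, true_and, Finset.mem_filter] at hp hq heq
    have hi := congrFun heq i
    by_cases hij : i = j
    · subst hij
      simp only [Function.update_self] at hi
      rw [hi]
    · rw [Function.update_self, Function.update_of_ne hij] at hi
      simp [hi] at hp
  · intro z hz
    rw [Finset.mem_filter] at hz
    obtain ⟨i, hi⟩ := exists_eq_update_of_l1dist_eq_one hz.2
    refine ⟨⟨i, z i⟩, ?_, hi.symm⟩
    have hz1 := hz.2
    rw [hi, l1dist_update] at hz1
    have hz2 := hz.1
    rw [boxQ, Fintype.mem_piFinset] at hz2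
    simp only [Finset.mem_sigma, Finset.mem_univ, true_and, Finset.mem_filter]
    exact ⟨hz2 i, hz1⟩
  · intros; rfl

theorem boxLap_mulVec (d ℓ : ℕ) (f : Site d → ℝ) (x : boxQ d ℓ) :
    (boxLap d ℓ).mulVec (fun y => f y) x
      = ∑ z ∈ (boxQ d ℓ).filter (fun z => l1dist z (x : Site d) = 1), (f x - f z) := by
  have hterm : ∀ y : Site d, (if (x : Site d) = y then
      (((boxQ d ℓ).filter fun z => l1dist z (x : Site d) = 1).card : ℝ)
      else if l1dist (x : Site d) y = 1 then -1 else 0) * f y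
      = (if (x : Site d) = y then
      (((boxQ d ℓ).filter fun z => l1dist z (x : Site d) = 1).card : ℝ) * f y else 0)
      + (if l1dist y (x : Site d) = 1 then - f y else 0) := by
    intro y
    by_cases hxy : (x : Site d) = y
    · subst hxy; simp [l1dist]
    · simp only [hxy, if_false, l1dist_comm (x : Site d) y]
      split_ifs <;> ring
  simp only [Matrix.mulVec, dotProduct, boxLap, hterm]
  rw [Finset.sum_coe_sort (boxQ d ℓ) (fun y => (if (x : Site d) = y then
      (((boxQ d ℓ).filter fun z => l1dist z (x : Site d) = 1).card : ℝ) * f y else 0)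
      + (if l1dist y (x : Site d) = 1 then - f y else 0)),
    Finset.sum_add_distrib, Finset.sum_ite_eq, if_pos x.2, ← Finset.sum_filter,
    Finset.sum_sub_distrib]
  simp [sub_eq_add_neg]

theorem boxLap_transpose (d ℓ : ℕ) : (boxLap d ℓ).transpose = boxLap d ℓ := by
  ext x y
  simp only [Matrix.transpose_apply, boxLap]
  by_cases h : (x : Site d) = y
  · simp [h]
  · simp [h, Ne.symm h, l1dist_comm]

theorem boxLap_mulVec_boxModes {d ℓ : ℕ} (k : Fin d → Fin ℓ) :
    (boxLap d ℓ).mulVec (boxModes d ℓ k) = boxEig k • boxModes d ℓ k := by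
  ext x
  set w : Site d → ℝ := fun z => ∏ i, pathCos ℓ (k i) (z i) / √(pathNormSq ℓ (k i)) with hw
  have hx : ∀ i, (x : Site d) i ∈ Finset.Icc 1 (ℓ : ℤ) := Fintype.mem_piFinset.1 x.2
  change (boxLap d ℓ).mulVec (fun y => w y) x = boxEig k * w x
  rw [boxLap_mulVec, sum_neighbors x.2, boxEig, Finset.sum_mul]
  refine Finset.sum_congr rfl fun i _ => ?_
  have hsplit : ∀ z : Site d, w z = pathCos ℓ (k i) (z i) * (1 / √(pathNormSq ℓ (k i)) *
      ∏ j ∈ Finset.univ.erase i, pathCos ℓ (k j) (z j) / √(pathNormSq ℓ (k j))) := by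
    intro z
    simp only [hw]
    rw [← Finset.mul_prod_erase _ _ (Finset.mem_univ i)]
    ring
  have hupd : ∀ s, w (Function.update (x : Site d) i s)
      = pathCos ℓ (k i) s * (1 / √(pathNormSq ℓ (k i)) *
      ∏ j ∈ Finset.univ.erase i, pathCos ℓ (k j) ((x : Site d) j) / √(pathNormSq ℓ (k j))) := by
    intro s
    rw [hsplit, Function.update_self]
    congr 2
    refine Finset.prod_congr rfl fun j hj => ?_
    rw [Function.update_of_ne (Finset.ne_of_mem_erase hj)]
  simp_rw [hupd, hsplit (x : Site d)]
  simp_rw [← sub_mul]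
  rw [← Finset.sum_mul, sum_pathCos_sub (hx i), mul_assoc]

theorem boxLap_mulVec_one (d ℓ : ℕ) : (boxLap d ℓ).mulVec 1 = 0 := by
  ext x
  have h := boxLap_mulVec d ℓ (fun _ => 1) x
  simp only [sub_self, Finset.sum_const_zero] at h
  exact h

theorem boxModes_dotProduct_boxLap_mulVec {d ℓ : ℕ} (k : Fin d → Fin ℓ) (f : boxQ d ℓ → ℝ) :
    boxModes d ℓ k ⬝ᵥ (boxLap d ℓ).mulVec f = boxEig k * (boxModes d ℓ k ⬝ᵥ f) := by
  rw [Matrix.dotProduct_mulVec, ← Matrix.mulVec_transpose, boxLap_transpose,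
    boxLap_mulVec_boxModes, smul_dotProduct, smul_eq_mul]

theorem boxModes_dotProduct_one {d ℓ : ℕ} {k : Fin d → Fin ℓ} (hk : boxEig k ≠ 0) :
    boxModes d ℓ k ⬝ᵥ 1 = 0 := by
  have h := boxModes_dotProduct_boxLap_mulVec k 1
  rw [boxLap_mulVec_one, dotProduct_zero] at h
  exact (mul_eq_zero.1 h.symm).resolve_left hk

theorem energy_eq_sum_modes {d ℓ : ℕ} {α g : boxQ d ℓ → ℝ}
    (hg : (boxLap d ℓ).mulVec g = centered d ℓ α) :
    ∑ x, centered d ℓ α x * g x = ∑ k, (boxEig k)⁻¹ * (boxModes d ℓ k ⬝ᵥ α) ^ 2 := by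
  have hpars : centered d ℓ α ⬝ᵥ g
      = (boxModes d ℓ).mulVec (centered d ℓ α) ⬝ᵥ (boxModes d ℓ).mulVec g := by
    rw [Matrix.dotProduct_mulVec, ← Matrix.mulVec_transpose, Matrix.mulVec_mulVec,
      boxModes_transpose_mul, Matrix.one_mulVec]
  change centered d ℓ α ⬝ᵥ g = _
  rw [hpars]
  refine Finset.sum_congr rfl fun k _ => ?_
  have h1 := boxModes_dotProduct_boxLap_mulVec k g
  rw [hg] at h1
  change (boxModes d ℓ k ⬝ᵥ centered d ℓ α) * (boxModes d ℓ k ⬝ᵥ g) = _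
  by_cases hk : boxEig k = 0
  · simp [h1, hk]
  have h2 : boxModes d ℓ k ⬝ᵥ centered d ℓ α = boxModes d ℓ k ⬝ᵥ α := by
    have : centered d ℓ α = α - ((∑ z, α z) / (ℓ : ℝ) ^ d) • (1 : boxQ d ℓ → ℝ) := by
      ext x; simp [centered]
    rw [this, dotProduct_sub, dotProduct_smul, boxModes_dotProduct_one hk, smul_zero, sub_zero]
  rw [h2] at h1 ⊢
  rw [h1]
  field_simp

section GaussianForms

open ProbabilityTheory

variable {ι : Type*} [Fintype ι]

theorem memLp_dotProduct_gaussian (v : ι → ℝ) :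
    MemLp (fun α : ι → ℝ => v ⬝ᵥ α) 2 (Measure.pi fun _ => gaussianReal 0 1) := by
  refine memLp_finsetSum _ fun i _ => MemLp.const_mul ?_ _
  exact (memLp_id_gaussianReal 2).comp_measurePreserving
    (measurePreserving_eval (fun _ : ι => gaussianReal 0 1) i)

theorem integral_sq_dotProduct_gaussian (v : ι → ℝ) :
    ∫ α : ι → ℝ, (v ⬝ᵥ α) ^ 2 ∂(Measure.pi fun _ => gaussianReal 0 1) = v ⬝ᵥ v := by
  have hX : ∀ i, MemLp (fun t : ℝ => v i * t) 2 (gaussianReal 0 1) := fun i =>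
    MemLp.const_mul (memLp_id_gaussianReal 2) _
  have hvar := variance_sum_pi hX
  have hfun : (∑ i, fun ω : ι → ℝ => v i * ω i) = fun α => v ⬝ᵥ α := by
    ext α; simp [dotProduct]
  have hmean : ∫ α : ι → ℝ, v ⬝ᵥ α ∂(Measure.pi fun _ => gaussianReal 0 1) = 0 := by
    simp only [dotProduct]
    rw [integral_finsetSum]
    · refine Finset.sum_eq_zero fun i _ => ?_
      rw [integral_const_mul,
        integral_comp_eval (μ := fun _ : ι => gaussianReal 0 1) (f := fun t : ℝ => t)
          aestronglyMeasurable_id]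
      simp
    · intro i _
      exact (((memLp_id_gaussianReal 2).comp_measurePreserving
        (measurePreserving_eval (fun _ : ι => gaussianReal 0 1) i)).integrable
          (by norm_num)).const_mul _
  rw [hfun, variance_eq_sub (memLp_dotProduct_gaussian v), hmean] at hvar
  have hid : ∀ i, Var[fun t : ℝ => v i * t; gaussianReal 0 1] = v i ^ 2 := fun i =>
    (variance_const_mul (v i) id _).trans (by rw [variance_id_gaussianReal]; simp)
  simp only [hid] at hvar
  simpa [dotProduct, sq] using hvar

end GaussianForms

theorem integral_energy {d ℓ : ℕ} {g : (boxQ d ℓ → ℝ) → (boxQ d ℓ → ℝ)}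
    (hg : ∀ α, (boxLap d ℓ).mulVec (g α) = centered d ℓ α) :
    ∫ α, (∑ x, centered d ℓ α x * g α x) ∂(disorderP d ℓ)
      = ∑ k : Fin d → Fin ℓ, (boxEig k)⁻¹ := by
  simp_rw [energy_eq_sum_modes (hg _), disorderP]
  rw [integral_finsetSum _ fun k _ =>
    ((memLp_dotProduct_gaussian (boxModes d ℓ k)).integrable_sq).const_mul _]
  refine Finset.sum_congr rfl fun k _ => ?_
  rw [integral_const_mul, integral_sq_dotProduct_gaussian]
  have h := congrFun (congrFun (boxModes_mul_transpose d ℓ) k) k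
  rw [Matrix.one_apply_eq] at h
  change boxModes d ℓ k ⬝ᵥ boxModes d ℓ k = 1 at h
  rw [h, mul_one]

theorem pathEig_nonneg (ℓ k : ℕ) : 0 ≤ pathEig ℓ k := by
  have := Real.cos_le_one (Real.pi * k / ℓ)
  unfold pathEig; linarith

theorem pathEig_le_four (ℓ k : ℕ) : pathEig ℓ k ≤ 4 := by
  have := Real.neg_one_le_cos (Real.pi * k / ℓ)
  unfold pathEig; linarith

theorem pathEig_le (ℓ k : ℕ) : pathEig ℓ k ≤ 10 * (k : ℝ) ^ 2 / (ℓ : ℝ) ^ 2 := by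
  have h := Real.one_sub_sq_div_two_le_cos (x := Real.pi * k / ℓ)
  have hpi : Real.pi ^ 2 ≤ 10 := by nlinarith [Real.pi_lt_d2, Real.pi_pos]
  have h2 : (Real.pi * k / ℓ) ^ 2 ≤ 10 * (k : ℝ) ^ 2 / (ℓ : ℝ) ^ 2 := by
    rw [div_pow, mul_pow]; gcongr
  unfold pathEig; linarith

theorem le_pathEig {ℓ k : ℕ} (hk : k < ℓ) : 4 * (k : ℝ) ^ 2 / (ℓ : ℝ) ^ 2 ≤ pathEig ℓ k := by
  have h0 : (0 : ℝ) < ℓ := by exact_mod_cast (by omega : 0 < ℓ)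
  have habs : |Real.pi * k / ℓ| ≤ Real.pi := by
    rw [abs_of_nonneg (by positivity), div_le_iff₀ h0]
    have : (k : ℝ) ≤ ℓ := by exact_mod_cast hk.le
    gcongr
  have h := Real.cos_le_one_sub_mul_cos_sq habs
  have h2 : 2 / Real.pi ^ 2 * (Real.pi * k / ℓ) ^ 2 = 2 * (k : ℝ) ^ 2 / (ℓ : ℝ) ^ 2 := by
    field_simp
  rw [h2] at h
  unfold pathEig
  have h3 : 4 * (k : ℝ) ^ 2 / (ℓ : ℝ) ^ 2 = 2 * (2 * (k : ℝ) ^ 2 / (ℓ : ℝ) ^ 2) := by ring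
  linarith

theorem boxEig_nonneg {d ℓ : ℕ} (k : Fin d → Fin ℓ) : 0 ≤ boxEig k :=
  Finset.sum_nonneg fun _ _ => pathEig_nonneg _ _

theorem boxEig_le {d ℓ : ℕ} (k : Fin d → Fin ℓ) : boxEig k ≤ 4 * d := by
  calc boxEig k ≤ ∑ _i : Fin d, (4 : ℝ) := Finset.sum_le_sum fun _ _ => pathEig_le_four _ _
    _ = 4 * d := by simp [mul_comm]

theorem le_boxEig {d ℓ : ℕ} (k : Fin d → Fin ℓ) (i : Fin d) :
    4 * (k i : ℝ) ^ 2 / (ℓ : ℝ) ^ 2 ≤ boxEig k :=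
  (le_pathEig (k i).2).trans
    (Finset.single_le_sum (f := fun i => pathEig ℓ (k i)) (fun _ _ => pathEig_nonneg _ _)
      (Finset.mem_univ i))

theorem boxEig_pos {d ℓ : ℕ} {k : Fin d → Fin ℓ} {i : Fin d} (hi : (k i : ℕ) ≠ 0) :
    0 < boxEig k := by
  have h0 : 0 < ℓ := (k i).pos
  have h1 : 0 < (k i : ℕ) := by omega
  exact lt_of_lt_of_le (by positivity) (le_boxEig k i)

/-- The sum `∑ (m+1)^{d-1} / m²` over `0 < m < ℓ`, the term `m = 0` vanishing. -/
def shellSum (d ℓ : ℕ) : ℝ :=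
  ∑ m ∈ Finset.range ℓ, ((m : ℝ) + 1) ^ (d - 1) * ((m : ℝ) ^ 2)⁻¹

/-- The frequencies whose largest coordinate is the `i`-th. -/
def maxAt {d : ℕ} (ℓ : ℕ) (i : Fin d) : Finset (Fin d → Fin ℓ) :=
  Finset.univ.filter fun k => ∀ j, k j ≤ k i

theorem card_maxAt_fiber {d ℓ : ℕ} (i : Fin d) (m : Fin ℓ) :
    ((maxAt ℓ i).filter fun k => k i = m).card = ((m : ℕ) + 1) ^ (d - 1) := by
  have h : (maxAt ℓ i).filter (fun k => k i = m)
      = Fintype.piFinset fun j => if j = i then {m} else Finset.Iic m := by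
    ext k
    simp only [maxAt, Finset.mem_filter, Finset.mem_univ, true_and, Fintype.mem_piFinset]
    constructor
    · rintro ⟨h, rfl⟩ j
      split_ifs with hj
      · simp [hj]
      · simpa using h j
    · intro h
      have hi : k i = m := by simpa using h i
      refine ⟨fun j => ?_, hi⟩
      by_cases hj : j = i
      · rw [hj]
      · simpa [hj, hi] using h j
  rw [h, Fintype.card_piFinset, ← Finset.mul_prod_erase _ _ (Finset.mem_univ i)]
  rw [Finset.prod_congr rfl (g := fun _ => (m : ℕ) + 1)]
  · simp
  · intro j hj
    simp [Finset.ne_of_mem_erase hj]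

theorem sum_maxAt {d ℓ : ℕ} (i : Fin d) :
    ∑ k ∈ maxAt ℓ i, ((k i : ℝ) ^ 2)⁻¹ = shellSum d ℓ := by
  rw [← Finset.sum_fiberwise_of_maps_to (t := Finset.univ) (g := fun k => k i)
    (fun _ _ => Finset.mem_univ _), shellSum, Finset.sum_range]
  refine Finset.sum_congr rfl fun m _ => ?_
  rw [Finset.sum_congr rfl (g := fun _ => ((m : ℝ) ^ 2)⁻¹), Finset.sum_const, card_maxAt_fiber]
  · simp
  · intro k hk
    rw [(Finset.mem_filter.1 hk).2]

theorem sum_inv_boxEig_le {d ℓ : ℕ} (hd : 0 < d) :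
    ∑ k : Fin d → Fin ℓ, (boxEig k)⁻¹ ≤ d * ((ℓ : ℝ) ^ 2 / 4 * shellSum d ℓ) := by
  have hsum : (d : ℝ) * ((ℓ : ℝ) ^ 2 / 4 * shellSum d ℓ)
      = ∑ k : Fin d → Fin ℓ, ∑ i, if k ∈ maxAt ℓ i then
          (ℓ : ℝ) ^ 2 / 4 * ((k i : ℝ) ^ 2)⁻¹ else 0 := by
    rw [Finset.sum_comm]
    simp_rw [← Finset.sum_filter, Finset.filter_mem_eq_inter, Finset.univ_inter,
      ← Finset.mul_sum, sum_maxAt]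
    simp [mul_left_comm]
  rw [hsum]
  refine Finset.sum_le_sum fun k _ => ?_
  have : Nonempty (Fin d) := ⟨⟨0, hd⟩⟩
  obtain ⟨i, hi⟩ := Finite.exists_max k
  have hmem : k ∈ maxAt ℓ i := by simpa [maxAt] using hi
  refine le_trans ?_ (Finset.single_le_sum (f := fun i => if k ∈ maxAt ℓ i then
          (ℓ : ℝ) ^ 2 / 4 * ((k i : ℝ) ^ 2)⁻¹ else 0)
    (fun j _ => by split_ifs <;> positivity) (Finset.mem_univ i))
  simp only [hmem, if_true]
  by_cases h0 : (k i : ℕ) = 0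
  · have hz : boxEig k = 0 := by
      refine Finset.sum_eq_zero fun j _ => ?_
      have : (k j : ℕ) = 0 := by have : (k j : ℕ) ≤ k i := hi j; omega
      simp [pathEig, this]
    simp [hz, h0]
  · have hℓ : 0 < ℓ := (k i).pos
    have h1 : 0 < (k i : ℕ) := by omega
    have h := inv_anti₀ (by positivity) (le_boxEig k i)
    refine h.trans (le_of_eq ?_)
    rw [inv_div]
    field_simp

theorem le_sum_inv_boxEig {d ℓ : ℕ} (i : Fin d) :
    (ℓ : ℝ) ^ 2 / (10 * d) * shellSum d ℓ ≤ ∑ k : Fin d → Fin ℓ, (boxEig k)⁻¹ := by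
  rw [← sum_maxAt i, Finset.mul_sum]
  refine le_trans (Finset.sum_le_sum fun k hk => ?_)
    (Finset.sum_le_sum_of_subset_of_nonneg (Finset.subset_univ (maxAt ℓ i))
      fun k _ _ => inv_nonneg.2 (boxEig_nonneg k))
  have hk' : ∀ j, k j ≤ k i := (Finset.mem_filter.1 hk).2
  by_cases h0 : (k i : ℕ) = 0
  · simpa [h0] using boxEig_nonneg k
  have hℓ : 0 < ℓ := (k i).pos
  have hle : boxEig k ≤ d * (10 * (k i : ℝ) ^ 2 / (ℓ : ℝ) ^ 2) := by
    calc boxEig k ≤ ∑ _j : Fin d, 10 * (k i : ℝ) ^ 2 / (ℓ : ℝ) ^ 2 := by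
          refine Finset.sum_le_sum fun j _ => (pathEig_le _ _).trans ?_
          have : ((k j : ℕ) : ℝ) ≤ (k i : ℕ) := by exact_mod_cast hk' j
          gcongr
      _ = _ := by simp
  refine le_trans (le_of_eq ?_) (inv_anti₀ (boxEig_pos h0) hle)
  have hd : (d : ℝ) ≠ 0 := by have := i.pos; positivity
  field_simp

theorem card_le_sum_inv_boxEig {d ℓ : ℕ} (hd : 1 ≤ d) (hℓ : 2 ≤ ℓ) :
    (ℓ : ℝ) ^ d / (8 * d) ≤ ∑ k : Fin d → Fin ℓ, (boxEig k)⁻¹ := by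
  have : NeZero ℓ := ⟨by omega⟩
  have hd0 : (0 : ℝ) < d := by exact_mod_cast hd
  have h1 : ∑ _k ∈ Finset.univ.erase (0 : Fin d → Fin ℓ), (4 * (d : ℝ))⁻¹
      ≤ ∑ k : Fin d → Fin ℓ, (boxEig k)⁻¹ := by
    refine le_trans (Finset.sum_le_sum fun k hk => ?_)
      (Finset.sum_le_sum_of_subset_of_nonneg (Finset.subset_univ _)
        fun k _ _ => inv_nonneg.2 (boxEig_nonneg k))
    obtain ⟨i, hi⟩ := Function.ne_iff.1 (Finset.ne_of_mem_erase hk)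
    refine inv_anti₀ (boxEig_pos (i := i) fun h => hi (Fin.ext (by simpa using h))) (boxEig_le k)
  refine le_trans ?_ h1
  have h2 : (2 : ℝ) ≤ (ℓ : ℝ) ^ d := by
    calc (2 : ℝ) ≤ ℓ := by exact_mod_cast hℓ
      _ ≤ (ℓ : ℝ) ^ d := le_self_pow₀ (by exact_mod_cast (by omega : 1 ≤ ℓ)) (by omega)
  rw [Finset.sum_const, Finset.card_erase_of_mem (Finset.mem_univ _), nsmul_eq_mul,
    Finset.card_univ, Fintype.card_fun, Fintype.card_fin, Fintype.card_fin,
    Nat.cast_pred (by positivity)]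
  push_cast
  rw [← div_eq_mul_inv, div_le_div_iff₀ (by positivity) (by positivity)]
  nlinarith

theorem shellSum_succ (d ℓ : ℕ) :
    shellSum d (ℓ + 1)
      = ∑ m ∈ Finset.range ℓ, ((m : ℝ) + 1 + 1) ^ (d - 1) * (((m : ℝ) + 1) ^ 2)⁻¹ := by
  rw [shellSum, Finset.sum_range_succ']
  simp

theorem log_le_shellSum_two {ℓ : ℕ} (hℓ : 1 ≤ ℓ) : Real.log ℓ ≤ shellSum 2 ℓ := by
  obtain ⟨n, rfl⟩ := Nat.exists_eq_add_of_le' hℓ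
  refine (log_add_one_le_harmonic n).trans ?_
  rw [shellSum_succ, harmonic]
  push_cast
  refine Finset.sum_le_sum fun m _ => ?_
  have : (0 : ℝ) < (m : ℝ) + 1 := by positivity
  rw [← div_eq_mul_inv, le_div_iff₀ (by positivity)]
  field_simp
  norm_num

theorem shellSum_two_le {ℓ : ℕ} (hℓ : 2 ≤ ℓ) : shellSum 2 ℓ ≤ 6 * Real.log ℓ := by
  obtain ⟨n, rfl⟩ := Nat.exists_eq_add_of_le' (by omega : 1 ≤ ℓ)
  have h1 : shellSum 2 (n + 1) ≤ 2 * (harmonic n : ℝ) := by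
    rw [shellSum_succ, harmonic]
    push_cast
    rw [Finset.mul_sum]
    refine Finset.sum_le_sum fun m _ => ?_
    have : (0 : ℝ) < (m : ℝ) + 1 := by positivity
    rw [← div_eq_mul_inv, div_le_iff₀ (by positivity)]
    field_simp
    linarith
  have h2 := harmonic_le_one_add_log n
  have h3 : Real.log n ≤ Real.log (n + 1 : ℕ) :=
    Real.log_le_log (by exact_mod_cast (by omega : 0 < n)) (by push_cast; linarith)
  have h4 : Real.log 2 ≤ Real.log (n + 1 : ℕ) :=
    Real.log_le_log (by norm_num) (by exact_mod_cast hℓ)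
  have h5 := Real.log_two_gt_d9
  linarith

theorem shellSum_le {d ℓ : ℕ} (hd : 3 ≤ d) : shellSum d ℓ ≤ 2 ^ (d - 1) * (ℓ : ℝ) ^ (d - 2) := by
  obtain ⟨e, rfl⟩ := Nat.exists_eq_add_of_le' hd
  have h : ∀ m ∈ Finset.range ℓ, ((m : ℝ) + 1) ^ (e + 3 - 1) * ((m : ℝ) ^ 2)⁻¹
      ≤ 2 ^ (e + 2) * (ℓ : ℝ) ^ e := by
    intro m hm
    rcases Nat.eq_zero_or_pos m with rfl | hm0
    · simp
    have hm1 : (1 : ℝ) ≤ m := by exact_mod_cast hm0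
    have hm2 : (m : ℝ) ≤ ℓ := by exact_mod_cast (Finset.mem_range.1 hm).le
    calc ((m : ℝ) + 1) ^ (e + 2) * ((m : ℝ) ^ 2)⁻¹
        ≤ (2 * m) ^ (e + 2) * ((m : ℝ) ^ 2)⁻¹ := by gcongr; linarith
      _ = 2 ^ (e + 2) * (m : ℝ) ^ e := by rw [mul_pow, pow_add (m : ℝ)]; field_simp
      _ ≤ _ := by gcongr
  calc shellSum (e + 3) ℓ ≤ ∑ _m ∈ Finset.range ℓ, 2 ^ (e + 2) * (ℓ : ℝ) ^ e :=
        Finset.sum_le_sum h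
    _ = 2 ^ (e + 3 - 1) * (ℓ : ℝ) ^ (e + 3 - 2) := by
        rw [Finset.sum_const, Finset.card_range, nsmul_eq_mul,
          show e + 3 - 1 = e + 2 by omega, show e + 3 - 2 = e + 1 by omega]
        ring

/-- Let `g(α)` be the unique mean-zero solution of `L g(α) = α̂` on the box
`Q_ℓ = {1,…,ℓ}^d` and `E_{Q_ℓ}(α) = Σ_x α̂_x g_x`.  Then there are constants `0 < c ≤ C`
such that for all `ℓ ≥ 2`:  if `d = 2` then
`c ℓ² log ℓ ≤ E[E_{Q_ℓ}(α)] ≤ C ℓ² log ℓ`, and if `d ≥ 3` then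
`c ℓ^d ≤ E[E_{Q_ℓ}(α)] ≤ C ℓ^d`. -/
theorem disorder_energy_order_of_magnitude (d : ℕ) (hd : 2 ≤ d) :
    ∃ c C : ℝ, 0 < c ∧ c ≤ C ∧
      ∀ ℓ : ℕ, 2 ≤ ℓ →
        ∀ g : (boxQ d ℓ → ℝ) → (boxQ d ℓ → ℝ),
          (∀ α, Matrix.mulVec (boxLap d ℓ) (g α) = centered d ℓ α) →
          (∀ α, ∑ x, g α x = 0) →
          (d = 2 →
            c * ((ℓ : ℝ) ^ 2 * Real.log ℓ) ≤
              (∫ α, (∑ x, centered d ℓ α x * g α x) ∂(disorderP d ℓ)) ∧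
            (∫ α, (∑ x, centered d ℓ α x * g α x) ∂(disorderP d ℓ)) ≤
              C * ((ℓ : ℝ) ^ 2 * Real.log ℓ)) ∧
          (3 ≤ d →
            c * (ℓ : ℝ) ^ d ≤
              (∫ α, (∑ x, centered d ℓ α x * g α x) ∂(disorderP d ℓ)) ∧
            (∫ α, (∑ x, centered d ℓ α x * g α x) ∂(disorderP d ℓ)) ≤
              C * (ℓ : ℝ) ^ d) := by
  have hd0 : (0 : ℝ) < d := by exact_mod_cast (by omega : 0 < d)
  set c : ℝ := 1 / (10 * d)
  set C : ℝ := d * 2 ^ (d + 1)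
  have hc : c ≤ C := by
    have h1 : (1 : ℝ) ≤ d := by exact_mod_cast (by omega : 1 ≤ d)
    have h2 : (1 : ℝ) ≤ 2 ^ (d + 1) := one_le_pow₀ (by norm_num)
    have h3 : c ≤ 1 := by
      rw [div_le_one (by positivity)]; linarith
    exact h3.trans (one_le_mul_of_one_le_of_one_le h1 h2)
  refine ⟨c, C, by positivity, hc, fun ℓ hℓ g hg _ => ?_⟩
  rw [integral_energy hg]
  have hlow := le_sum_inv_boxEig (ℓ := ℓ) (⟨0, by omega⟩ : Fin d)
  have hupp := sum_inv_boxEig_le (ℓ := ℓ) (by omega : 0 < d)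
  refine ⟨?_, fun h3 => ⟨?_, ?_⟩⟩
  · rintro rfl
    constructor
    · refine le_trans ?_ hlow
      have := log_le_shellSum_two (by omega : 1 ≤ ℓ)
      calc c * ((ℓ : ℝ) ^ 2 * Real.log ℓ) = (ℓ : ℝ) ^ 2 / (10 * (2 : ℕ)) * Real.log ℓ := by
            simp only [c]; ring
        _ ≤ _ := by gcongr
    · refine hupp.trans ?_
      have h := shellSum_two_le hℓ
      have hlog : 0 ≤ Real.log ℓ := Real.log_natCast_nonneg ℓ
      calc ((2 : ℕ) : ℝ) * ((ℓ : ℝ) ^ 2 / 4 * shellSum 2 ℓ)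
          ≤ ((2 : ℕ) : ℝ) * ((ℓ : ℝ) ^ 2 / 4 * (6 * Real.log ℓ)) := by gcongr
        _ = 3 * ((ℓ : ℝ) ^ 2 * Real.log ℓ) := by push_cast; ring
        _ ≤ C * ((ℓ : ℝ) ^ 2 * Real.log ℓ) := by
            gcongr
            simp only [C]; norm_num
  · refine le_trans ?_ (card_le_sum_inv_boxEig (by omega) hℓ)
    rw [div_mul_eq_mul_div, one_mul]
    gcongr
    norm_num
  · refine hupp.trans ?_
    have h := shellSum_le (ℓ := ℓ) h3
    obtain ⟨e, rfl⟩ := Nat.exists_eq_add_of_le' h3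
    calc ((e + 3 : ℕ) : ℝ) * ((ℓ : ℝ) ^ 2 / 4 * shellSum (e + 3) ℓ)
        ≤ ((e + 3 : ℕ) : ℝ) * ((ℓ : ℝ) ^ 2 / 4 *
            (2 ^ (e + 3 - 1) * (ℓ : ℝ) ^ (e + 3 - 2))) := by gcongr
      _ = ((e + 3 : ℕ) : ℝ) * 2 ^ e * (ℓ : ℝ) ^ (e + 3) := by
          rw [show e + 3 - 1 = e + 2 by omega, show e + 3 - 2 = e + 1 by omega]
          ring
      _ ≤ C * (ℓ : ℝ) ^ (e + 3) := by
          simp only [C]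
          gcongr
          · norm_num
          · omega

end
end
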